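/- Let {S_{a*}} be a convergent stationary subdivision scheme given by a finitely supported mask a* reproducing constants, whose difference mask q* satisfies ‖(S_{q*})^n‖ < 1 for some positive integer n, and set μ* := ‖(S_{q*})^n‖. Let {S_{a^[k]}, k≥0} be a local non-stationary subdivision scheme which reproduces constants and is asymptotically similar to the constant scheme {a*}. Then {S_{a^[k]}, k≥0} converges, and for every η ∈ ((μ*)^{1/n}, 1) there exists a positive constant C such that for every bounded initial sequence f^[0] and every k ≥ 0, ‖S^∞ f^[0] − PL(f^[k+1])‖_∞ ≤ C η^k ‖Δ f^[0]‖_∞. -/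

import Mathlib

open Filter Set

/-- The subdivision operator associated to a mask `a`: `(S_a f)_i = ∑_j a_{i-2j} f_j`. -/
noncomputable def subOp (a : ℤ → ℝ) (f : ℤ → ℝ) : ℤ → ℝ :=
  fun i => ∑ᶠ j : ℤ, a (i - 2 * j) * f j

/-- The difference mask `q` of a mask `a`: `q_i = ∑_{j ≤ i} (-1)^(i-j) a_j`. -/
noncomputable def diffMask (a : ℤ → ℝ) : ℤ → ℝ :=
  fun i => ∑ᶠ j ∈ {j : ℤ | j ≤ i}, (-1 : ℝ) ^ (i - j) * a j

/-- A sequence is bounded. -/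
def IsBoundedSeq (f : ℤ → ℝ) : Prop := ∃ M : ℝ, ∀ i, |f i| ≤ M

/-- Sup-norm of a sequence. -/
noncomputable def seqNorm (f : ℤ → ℝ) : ℝ := ⨆ i : ℤ, |f i|

/-- Operator sup-norm of an operator on sequences, taken over bounded sequences of
sup-norm at most one. -/
noncomputable def opNorm (T : (ℤ → ℝ) → ℤ → ℝ) : ℝ :=
  sSup { c : ℝ | ∃ f : ℤ → ℝ, IsBoundedSeq f ∧ seqNorm f ≤ 1 ∧ c = seqNorm (T f) }

/-- The hat function `H(x) = max (1 - |x|) 0`. -/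
noncomputable def hatF (x : ℝ) : ℝ := max (1 - |x|) 0

/-- The piecewise linear interpolant at level `k` of the data `f` on the grid `2^{-k} ℤ`. -/
noncomputable def PL (k : ℕ) (f : ℤ → ℝ) : ℝ → ℝ :=
  fun x => ∑ᶠ i : ℤ, f i * hatF (2 ^ k * x - (i : ℝ))

/-- Backward difference operator on sequences. -/
def bdiff (f : ℤ → ℝ) : ℤ → ℝ := fun i => f i - f (i - 1)

/-- `compOps q k n = S_{q^[k+n-1]} ∘ ⋯ ∘ S_{q^[k+1]} ∘ S_{q^[k]}`. -/
noncomputable def compOps (q : ℕ → ℤ → ℝ) (k : ℕ) : ℕ → (ℤ → ℝ) → ℤ → ℝ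
  | 0 => id
  | n + 1 => subOp (q (k + n)) ∘ compOps q k n

/-- A mask reproduces constants: `∑_i a_{2i} = ∑_i a_{2i+1} = 1`. -/
def ReproducesConstants (a : ℤ → ℝ) : Prop :=
  (∑ᶠ i : ℤ, a (2 * i)) = 1 ∧ (∑ᶠ i : ℤ, a (2 * i + 1)) = 1

/-- Two sequences of masks are asymptotically similar. -/
def AsympSimilar (a b : ℕ → ℤ → ℝ) : Prop :=
  Tendsto (fun k => seqNorm (fun i => a k i - b k i)) atTop (nhds 0)

/-- Condition A for a non-stationary scheme with masks `a`. -/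
def ConditionA (a : ℕ → ℤ → ℝ) : Prop :=
  ∃ K n : ℕ, 0 < n ∧ ∃ μ : ℝ, μ < 1 ∧
    ∀ k, K ≤ k → opNorm (compOps (fun j => diffMask (a j)) k n) ≤ μ

def SuppIn (M : ℕ) (q : ℤ → ℝ) : Prop := ∀ i : ℤ, (M : ℤ) < |i| → q i = 0

def Bd (c : ℝ) (f : ℤ → ℝ) : Prop := ∀ i, |f i| ≤ c

noncomputable def JJ (M : ℕ) (i : ℤ) : Finset ℤ := Finset.Icc (i / 2 - M - 1) (i / 2 + M + 1)

lemma Bd.nonneg {c : ℝ} {f : ℤ → ℝ} (h : Bd c f) : 0 ≤ c := (abs_nonneg _).trans (h 0)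

lemma subOp_eq {M : ℕ} {q : ℤ → ℝ} (hq : SuppIn M q) (f : ℤ → ℝ) (i : ℤ) :
    subOp q f i = ∑ j ∈ JJ M i, q (i - 2 * j) * f j := by
  unfold subOp
  apply finsum_eq_sum_of_support_subset
  intro j hj
  by_contra hc
  apply hj
  have : q (i - 2 * j) = 0 := by
    apply hq
    simp only [JJ, Finset.coe_Icc, Set.mem_Icc] at hc
    rw [lt_abs]
    omega
  simp [this]

lemma JJ_card (M : ℕ) (i : ℤ) : ((JJ M i).card : ℝ) = 2 * M + 3 := by
  have : (JJ M i).card = 2 * M + 3 := by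
    simp only [JJ, Int.card_Icc]; omega
  rw [this]; push_cast; ring

lemma subOp_bd {M : ℕ} {q f : ℤ → ℝ} {b c : ℝ} (hq : SuppIn M q) (hb : Bd b q) (hc : Bd c f) :
    Bd ((2 * M + 3) * b * c) (subOp q f) := by
  intro i
  rw [subOp_eq hq]
  calc |∑ j ∈ JJ M i, q (i - 2 * j) * f j| ≤ ∑ j ∈ JJ M i, |q (i - 2 * j) * f j| :=
        Finset.abs_sum_le_sum_abs _ _
    _ ≤ ∑ j ∈ JJ M i, b * c := by
        apply Finset.sum_le_sum
        intro j _
        rw [abs_mul]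
        exact mul_le_mul (hb _) (hc _) (abs_nonneg _) hb.nonneg
    _ = _ := by rw [Finset.sum_const, nsmul_eq_mul, JJ_card]; ring

lemma SuppIn.sub {M : ℕ} {p q : ℤ → ℝ} (hp : SuppIn M p) (hq : SuppIn M q) :
    SuppIn M (p - q) := by
  intro i hi
  simp [hp i hi, hq i hi]

lemma subOp_sub_mask {M : ℕ} {p q : ℤ → ℝ} (hp : SuppIn M p) (hq : SuppIn M q) (f : ℤ → ℝ) :
    subOp (p - q) f = subOp p f - subOp q f := by
  ext i
  rw [Pi.sub_apply, subOp_eq (hp.sub hq), subOp_eq hp, subOp_eq hq, ← Finset.sum_sub_distrib]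
  apply Finset.sum_congr rfl
  intro j _
  simp only [Pi.sub_apply]; ring

lemma subOp_sub_seq {M : ℕ} {q : ℤ → ℝ} (hq : SuppIn M q) (f g : ℤ → ℝ) :
    subOp q (f - g) = subOp q f - subOp q g := by
  ext i
  rw [Pi.sub_apply, subOp_eq hq, subOp_eq hq, subOp_eq hq, ← Finset.sum_sub_distrib]
  apply Finset.sum_congr rfl
  intro j _
  simp only [Pi.sub_apply]; ring

lemma subOp_smul {M : ℕ} {q : ℤ → ℝ} (hq : SuppIn M q) (c : ℝ) (f : ℤ → ℝ) :
    subOp q (c • f) = c • subOp q f := by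
  ext i
  rw [Pi.smul_apply, subOp_eq hq, subOp_eq hq, Finset.smul_sum]
  apply Finset.sum_congr rfl
  intro j _
  simp only [Pi.smul_apply, smul_eq_mul]; ring

lemma subOp_const {M : ℕ} {q : ℤ → ℝ} (hq : SuppIn M q) (hr : ReproducesConstants q) (m : ℤ) :
    ∑ j ∈ JJ M m, q (m - 2 * j) = 1 := by
  have h := subOp_eq hq (fun _ => 1) m
  simp only [mul_one] at h
  rw [← h, subOp]
  simp only [mul_one]
  rcases Int.even_or_odd' m with ⟨p, rfl | rfl⟩
  · rw [← hr.1]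
    rw [← finsum_comp_equiv (Equiv.subLeft p)]
    apply finsum_congr
    intro j
    congr 1
    simp; ring
  · rw [← hr.2]
    rw [← finsum_comp_equiv (Equiv.subLeft p)]
    apply finsum_congr
    intro j
    congr 1
    simp; ring

lemma diffMask_eq {M : ℕ} {q : ℤ → ℝ} (hq : SuppIn M q) (i : ℤ) :
    diffMask q i = ∑ j ∈ Finset.Icc (-(M : ℤ)) M, if j ≤ i then (-1 : ℝ) ^ (i - j) * q j else 0 := by
  unfold diffMask
  have : ∀ j, (∑ᶠ (_ : j ∈ {j : ℤ | j ≤ i}), (-1 : ℝ) ^ (i - j) * q j)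
      = if j ≤ i then (-1 : ℝ) ^ (i - j) * q j else 0 := by
    intro j
    rw [finsum_eq_if]; rfl
  simp only [this]
  apply finsum_eq_sum_of_support_subset
  intro j hj
  by_contra hc
  apply hj
  have : q j = 0 := by
    apply hq
    simp only [Finset.coe_Icc, Set.mem_Icc] at hc
    rw [lt_abs]
    omega
  simp [this]

lemma diffMask_sub {M : ℕ} {p q : ℤ → ℝ} (hp : SuppIn M p) (hq : SuppIn M q) :
    diffMask (p - q) = diffMask p - diffMask q := by
  ext i
  rw [Pi.sub_apply, diffMask_eq (hp.sub hq), diffMask_eq hp, diffMask_eq hq,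
    ← Finset.sum_sub_distrib]
  apply Finset.sum_congr rfl
  intro j _
  simp only [Pi.sub_apply]
  split_ifs
  · ring
  · ring

lemma diffMask_bd {M : ℕ} {q : ℤ → ℝ} {b : ℝ} (hq : SuppIn M q) (hb : Bd b q) :
    Bd ((2 * M + 1) * b) (diffMask q) := by
  intro i
  rw [diffMask_eq hq]
  refine (Finset.abs_sum_le_sum_abs _ _).trans ?_
  calc _ ≤ ∑ j ∈ Finset.Icc (-(M : ℤ)) M, b := by
        apply Finset.sum_le_sum
        intro j _
        split_ifs
        · rw [abs_mul, abs_zpow]; simpa using hb j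
        · simpa using hb.nonneg
    _ = _ := by
      rw [Finset.sum_const, nsmul_eq_mul]
      have : (Finset.Icc (-(M : ℤ)) M).card = 2 * M + 1 := by
        simp only [Int.card_Icc]; omega
      rw [this]; push_cast; ring

lemma diffMask_rec {M : ℕ} {q : ℤ → ℝ} (hq : SuppIn M q) (i : ℤ) :
    diffMask q i + diffMask q (i - 1) = q i := by
  rw [diffMask_eq hq, diffMask_eq hq, ← Finset.sum_add_distrib]
  have : ∀ j ∈ Finset.Icc (-(M : ℤ)) M,
      ((if j ≤ i then (-1 : ℝ) ^ (i - j) * q j else 0) +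
        if j ≤ i - 1 then (-1 : ℝ) ^ (i - 1 - j) * q j else 0) = if j = i then q i else 0 := by
    intro j _
    rcases lt_trichotomy j i with h | h | h
    · rw [if_pos h.le, if_pos (by omega), if_neg h.ne]
      have : i - j = (i - 1 - j) + 1 := by ring
      rw [this, zpow_add_one₀ (by norm_num)]; ring
    · subst h
      simp
    · rw [if_neg (by omega), if_neg (by omega), if_neg h.ne']; simp
  rw [Finset.sum_congr rfl this, Finset.sum_ite_eq']
  split_ifs with h
  · rfl
  · symm
    apply hq
    simp only [Finset.mem_Icc] at h
    rw [lt_abs]; omega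

lemma finsum_even_odd {F : ℤ → ℝ} (hF : (Function.support F).Finite) :
    ∑ᶠ j, F j = (∑ᶠ i, F (2 * i)) + ∑ᶠ i, F (2 * i + 1) := by
  have h1 : Function.Injective (fun i : ℤ => 2 * i) := fun a b h => by simpa using h
  have h2 : Function.Injective (fun i : ℤ => 2 * i + 1) := fun a b h => by simpa using h
  have hu : (Set.univ : Set ℤ) = Set.range (fun i : ℤ => 2 * i) ∪ Set.range (fun i : ℤ => 2 * i + 1) := by
    ext j
    simp only [Set.mem_univ, Set.mem_union, Set.mem_range, true_iff]
    rcases Int.even_or_odd' j with ⟨p, h | h⟩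
    · exact Or.inl ⟨p, h.symm⟩
    · exact Or.inr ⟨p, h.symm⟩
  rw [← finsum_mem_univ F, hu, ← finsum_mem_range (f := F) h1, ← finsum_mem_range (f := F) h2,
    ← finsum_mem_union']
  · rw [Set.disjoint_left]
    rintro _ ⟨x, rfl⟩ ⟨y, hy⟩
    simp only at hy; omega
  · exact hF.inter_of_right _
  · exact hF.inter_of_right _

lemma SuppIn.finite {M : ℕ} {q : ℤ → ℝ} (hq : SuppIn M q) : (Function.support q).Finite := by
  apply (Finset.Icc (-(M : ℤ)) M).finite_toSet.subset
  intro j hj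
  by_contra hc
  apply hj
  apply hq
  simp only [Finset.coe_Icc, Set.mem_Icc] at hc
  rw [lt_abs]
  omega

lemma diffMask_supp {M : ℕ} {q : ℤ → ℝ} (hq : SuppIn M q) (hr : ReproducesConstants q) :
    SuppIn M (diffMask q) := by
  intro i hi
  rcases lt_abs.1 hi with h | h
  · have e : diffMask q i = (-1 : ℝ) ^ i * ∑ᶠ j, (-1 : ℝ) ^ j * q j := by
      rw [diffMask_eq hq, finsum_eq_sum_of_support_subset (s := Finset.Icc (-(M : ℤ)) M),
        Finset.mul_sum]
      · apply Finset.sum_congr rfl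
        intro j hj
        rw [Finset.mem_Icc] at hj
        rw [if_pos (by omega), sub_eq_add_neg, zpow_add₀ (by norm_num), zpow_neg, ← inv_zpow]
        norm_num [mul_assoc]
      · intro j hj
        by_contra hc
        apply hj
        have : q j = 0 := by
          apply hq
          simp only [Finset.coe_Icc, Set.mem_Icc] at hc
          rw [lt_abs]
          omega
        simp [this]
    rw [e, finsum_even_odd]
    · have e1 : ∀ i : ℤ, (-1 : ℝ) ^ (2 * i) = 1 := fun i => by rw [zpow_mul]; norm_num
      have e2 : ∀ i : ℤ, (-1 : ℝ) ^ (2 * i + 1) = -1 := fun i => by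
        rw [zpow_add_one₀ (by norm_num), e1]; norm_num
      simp only [e1, e2, one_mul, neg_one_mul, finsum_neg_distrib, hr.1, hr.2]
      norm_num
    · apply hq.finite.subset
      intro j hj hc
      apply hj
      simp [hc]
  · rw [diffMask_eq hq]
    apply Finset.sum_eq_zero
    intro j hj
    rw [Finset.mem_Icc] at hj
    rw [if_neg (by omega)]

lemma finsum_mul_finite {M : ℕ} {q : ℤ → ℝ} (hq : SuppIn M q) (f : ℤ → ℝ) (i : ℤ) :
    (Function.support fun j => q (i - 2 * j) * f j).Finite := by
  apply (JJ M i).finite_toSet.subset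
  intro j hj
  by_contra hc
  apply hj
  have : q (i - 2 * j) = 0 := by
    apply hq
    simp only [JJ, Finset.coe_Icc, Set.mem_Icc] at hc
    rw [lt_abs]
    omega
  simp [this]

lemma bdiff_subOp {M : ℕ} {q : ℤ → ℝ} (hq : SuppIn M q) (hr : ReproducesConstants q)
    (f : ℤ → ℝ) : bdiff (subOp q f) = subOp (diffMask q) (bdiff f) := by
  have hd := diffMask_supp hq hr
  have e : bdiff f = f - fun i => f (i - 1) := rfl
  rw [e, subOp_sub_seq hd]
  ext i
  have e2 : subOp (diffMask q) (fun i => f (i - 1)) i = subOp (diffMask q) f (i - 2) := by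
    simp only [subOp]
    rw [← finsum_comp_equiv (Equiv.addRight (1 : ℤ))]
    apply finsum_congr
    intro j
    simp only [Equiv.coe_addRight, add_sub_cancel_right]
    congr 2; ring
  rw [Pi.sub_apply, e2]
  simp only [bdiff, subOp]
  rw [← finsum_sub_distrib (finsum_mul_finite hq f i) (finsum_mul_finite hq f (i - 1)),
    ← finsum_sub_distrib (finsum_mul_finite hd f i) (finsum_mul_finite hd f (i - 2))]
  apply finsum_congr
  intro j
  have h1 := diffMask_rec hq (i - 2 * j)
  have h2 := diffMask_rec hq (i - 1 - 2 * j)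
  have h3 : i - 2 * j - 1 = i - 1 - 2 * j := by ring
  have h4 : i - 1 - 2 * j - 1 = i - 2 - 2 * j := by ring
  rw [h3] at h1
  rw [h4] at h2
  rw [← h1, ← h2]; ring

lemma iter_bd {M : ℕ} {q f : ℤ → ℝ} {b c : ℝ} (hq : SuppIn M q) (hb : Bd b q) (hc : Bd c f)
    (m : ℕ) : Bd (((2 * M + 3) * b) ^ m * c) ((subOp q)^[m] f) := by
  induction m with
  | zero => simpa using hc
  | succ m ih =>
    rw [Function.iterate_succ_apply']
    have := subOp_bd hq hb ih
    convert this using 1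
    ring

lemma iter_smul {M : ℕ} {q : ℤ → ℝ} (hq : SuppIn M q) (c : ℝ) (f : ℤ → ℝ) (m : ℕ) :
    (subOp q)^[m] (c • f) = c • (subOp q)^[m] f := by
  induction m with
  | zero => rfl
  | succ m ih =>
    rw [Function.iterate_succ_apply', Function.iterate_succ_apply', ih, subOp_smul hq]

lemma Bd.mono {c d : ℝ} {f : ℤ → ℝ} (h : Bd c f) (hcd : c ≤ d) : Bd d f :=
  fun i => (h i).trans hcd

lemma Bd.add {c d : ℝ} {f g : ℤ → ℝ} (h : Bd c f) (h' : Bd d g) : Bd (c + d) (f + g) :=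
  fun i => (abs_add_le _ _).trans (add_le_add (h i) (h' i))

lemma Bd.seqNorm_le {c : ℝ} {f : ℤ → ℝ} (h : Bd c f) : seqNorm f ≤ c := ciSup_le h

lemma Bd.seqNorm {c : ℝ} {f : ℤ → ℝ} (h : Bd c f) : Bd (seqNorm f) f := by
  intro i
  exact le_ciSup (f := fun i => |f i|) ⟨c, by rintro _ ⟨j, rfl⟩; exact h j⟩ i

lemma seqNorm_nonneg (f : ℤ → ℝ) : 0 ≤ seqNorm f := Real.iSup_nonneg fun _ => abs_nonneg _

lemma opNorm_nonneg (T : (ℤ → ℝ) → ℤ → ℝ) : 0 ≤ opNorm T := by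
  apply Real.sSup_nonneg
  rintro _ ⟨f, _, _, rfl⟩
  exact seqNorm_nonneg _

lemma opNorm_bd {M : ℕ} {q f : ℤ → ℝ} {b c : ℝ} (hq : SuppIn M q) (hb : Bd b q) (hc : Bd c f)
    (m : ℕ) : Bd (opNorm ((subOp q)^[m]) * c) ((subOp q)^[m] f) := by
  rcases hc.nonneg.eq_or_lt with h0 | h0
  · subst h0
    simpa using iter_bd hq hb hc m
  · have h1 : Bd 1 (c⁻¹ • f) := by
      intro i
      rw [Pi.smul_apply, smul_eq_mul, abs_mul, abs_inv, abs_of_pos h0, inv_mul_le_iff₀ h0]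
      simpa using hc i
    have h2 : seqNorm ((subOp q)^[m] (c⁻¹ • f)) ≤ opNorm ((subOp q)^[m]) := by
      apply le_csSup
      · refine ⟨((2 * M + 3) * b) ^ m * 1, ?_⟩
        rintro _ ⟨g, ⟨B, hB⟩, hg, rfl⟩
        have hg1 : Bd 1 g := (Bd.seqNorm (c := B) hB).mono hg
        exact (iter_bd hq hb hg1 m).seqNorm_le
      · exact ⟨_, ⟨1, h1⟩, h1.seqNorm_le, rfl⟩
    have h3 := ((iter_bd hq hb h1 m).seqNorm).mono h2
    intro i
    have := h3 i
    rw [iter_smul hq, Pi.smul_apply, smul_eq_mul, abs_mul, abs_inv, abs_of_pos h0,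
      inv_mul_le_iff₀ h0] at this
    linarith

lemma rec_bd {M : ℕ} {p : ℕ → ℤ → ℝ} {b : ℝ} (hp : ∀ k, SuppIn M (p k)) (hb : ∀ k, Bd b (p k))
    {D : ℕ → ℤ → ℝ} (hD : ∀ k, D (k + 1) = subOp (p k) (D k)) {k : ℕ} {c : ℝ} (hc : Bd c (D k))
    (m : ℕ) : Bd (((2 * M + 3) * b) ^ m * c) (D (k + m)) := by
  induction m with
  | zero => simpa using hc
  | succ m ih =>
    rw [← add_assoc, hD]
    have := subOp_bd (hp (k + m)) (hb (k + m)) ih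
    convert this using 1
    ring

lemma perturb {M : ℕ} {p : ℕ → ℤ → ℝ} {q : ℤ → ℝ} {b : ℝ} (hp : ∀ k, SuppIn M (p k))
    (hb : ∀ k, Bd b (p k)) (hq : SuppIn M q) (hqb : Bd b q)
    (hlim : ∀ ε > 0, ∃ K : ℕ, ∀ k ≥ K, Bd ε (p k - q)) (m : ℕ) :
    ∀ ε > 0, ∃ K : ℕ, ∀ k ≥ K, ∀ D : ℕ → ℤ → ℝ, (∀ k, D (k + 1) = subOp (p k) (D k)) →
      ∀ c, Bd c (D k) → Bd (ε * c) (D (k + m) - (subOp q)^[m] (D k)) := by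
  induction m with
  | zero =>
    intro ε hε
    refine ⟨0, fun k _ D _ c hc i => ?_⟩
    simpa using mul_nonneg hε.le hc.nonneg
  | succ m ih =>
    intro ε hε
    have hb0 : 0 ≤ b := hqb.nonneg
    set A : ℝ := (2 * M + 3) * b with hA
    have hA0 : 0 ≤ A := by positivity
    obtain ⟨K1, hK1⟩ := ih (ε / 2 / (A + 1)) (by positivity)
    obtain ⟨K2, hK2⟩ := hlim (ε / 2 / ((2 * M + 3) * (A ^ m + 1))) (by positivity)
    refine ⟨max K1 K2, fun k hk D hD c hc => ?_⟩
    have hc0 := hc.nonneg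
    have e1 := hK1 k ((le_max_left _ _).trans hk) D hD c hc
    have e2 := hK2 (k + m) (((le_max_right _ _).trans hk).trans (Nat.le_add_right _ _))
    have e3 := rec_bd hp hb hD hc m
    have e4 := subOp_bd ((hp _).sub hq) e2 e3
    have e5 := subOp_bd hq hqb e1
    have e6 := e4.add e5
    rw [subOp_sub_mask (hp _) hq, subOp_sub_seq hq, sub_add_sub_cancel, ← hD,
      ← Function.iterate_succ_apply' (subOp q)] at e6
    rw [← add_assoc]
    refine e6.mono ?_
    have t1 : (2 * (M : ℝ) + 3) * (ε / 2 / ((2 * M + 3) * (A ^ m + 1))) * (A ^ m * c)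
        ≤ ε / 2 * c := by
      have : (2 * (M : ℝ) + 3) * (ε / 2 / ((2 * M + 3) * (A ^ m + 1))) * (A ^ m * c)
        = ε / 2 * c * (A ^ m / (A ^ m + 1)) := by
        have : A ^ m + 1 ≠ 0 := by positivity
        field_simp
      rw [this]
      apply mul_le_of_le_one_right (by positivity)
      rw [div_le_one (by positivity)]; linarith
    have t2 : A * (ε / 2 / (A + 1) * c) ≤ ε / 2 * c := by
      have : A * (ε / 2 / (A + 1) * c) = ε / 2 * c * (A / (A + 1)) := by
        field_simp
      rw [this]
      apply mul_le_of_le_one_right (by positivity)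
      rw [div_le_one (by positivity)]; linarith
    linarith

lemma decay {M : ℕ} {p : ℕ → ℤ → ℝ} {b : ℝ} (hp : ∀ k, SuppIn M (p k)) (hb : ∀ k, Bd b (p k))
    {n K : ℕ} (hn : 0 < n) {η : ℝ} (hη : 0 < η)
    (H : ∀ k ≥ K, ∀ D : ℕ → ℤ → ℝ, (∀ k, D (k + 1) = subOp (p k) (D k)) →
      ∀ c, Bd c (D k) → Bd (η ^ n * c) (D (k + n))) :
    ∃ C : ℝ, 0 < C ∧ ∀ D : ℕ → ℤ → ℝ, (∀ k, D (k + 1) = subOp (p k) (D k)) →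
      ∀ c, Bd c (D 0) → ∀ k, Bd (C * η ^ k * c) (D k) := by
  have hb0 : 0 ≤ b := (hb 0).nonneg
  set A : ℝ := (2 * M + 3) * b with hA
  have hA0 : 0 ≤ A := by positivity
  set R := max 1 (A / η) with hR
  have hR1 : 1 ≤ R := le_max_left _ _
  refine ⟨R ^ (K + n), by positivity, fun D hD c hc k => ?_⟩
  have hc0 := hc.nonneg
  induction k using Nat.strong_induction_on with
  | _ k ih =>
    by_cases hk : k < K + n
    · have h1 := rec_bd hp hb hD hc k
      rw [zero_add] at h1
      refine h1.mono ?_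
      rw [← hA]
      apply mul_le_mul_of_nonneg_right _ hc0
      have h2 : A ^ k = (A / η) ^ k * η ^ k := by
        rw [← mul_pow, div_mul_cancel₀ _ hη.ne']
      rw [h2]
      apply mul_le_mul_of_nonneg_right _ (by positivity)
      calc (A / η) ^ k ≤ R ^ k := pow_le_pow_left₀ (by positivity) (le_max_right _ _) _
        _ ≤ R ^ (K + n) := pow_le_pow_right₀ hR1 hk.le
    · obtain ⟨j, rfl⟩ : ∃ j, k = j + n := ⟨k - n, by omega⟩
      have h1 := H j (by omega) D hD _ (ih j (by omega))
      refine h1.mono (le_of_eq ?_)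
      rw [pow_add η j n]; ring

lemma PL_eq (k : ℕ) (f : ℤ → ℝ) (x : ℝ) :
    PL k f x = f ⌊2 ^ k * x⌋ + Int.fract (2 ^ k * x) * (f (⌊2 ^ k * x⌋ + 1) - f ⌊2 ^ k * x⌋) := by
  unfold PL
  set y : ℝ := 2 ^ k * x
  have e : ((⌊y⌋ : ℤ) : ℝ) + Int.fract y = y := Int.floor_add_fract y
  have f0 := Int.fract_nonneg y
  have f1 := Int.fract_lt_one y
  rw [finsum_eq_sum_of_support_subset (s := {⌊y⌋, ⌊y⌋ + 1})]
  · rw [Finset.sum_pair (by omega)]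
    have h1 : hatF (y - (⌊y⌋ : ℤ)) = 1 - Int.fract y := by
      have : y - (⌊y⌋ : ℤ) = Int.fract y := by linarith
      rw [this, hatF, abs_of_nonneg f0, max_eq_left (by linarith)]
    have h2 : hatF (y - ((⌊y⌋ + 1 : ℤ) : ℝ)) = Int.fract y := by
      have : y - ((⌊y⌋ + 1 : ℤ) : ℝ) = -(1 - Int.fract y) := by push_cast; linarith
      rw [this, hatF, abs_neg, abs_of_nonneg (by linarith), max_eq_left (by linarith)]
      ring
    rw [h1, h2]; ring
  · intro j hj
    by_contra hc
    apply hj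
    have : hatF (y - (j : ℝ)) = 0 := by
      rw [hatF]
      apply max_eq_right
      simp only [Finset.coe_insert, Finset.coe_singleton, Set.mem_insert_iff,
        Set.mem_singleton_iff, not_or] at hc
      rcases lt_or_gt_of_ne hc.1 with h | h
      · have : (j : ℝ) ≤ (⌊y⌋ : ℝ) - 1 := by exact_mod_cast (by omega : j ≤ ⌊y⌋ - 1)
        have := le_abs_self (y - j)
        linarith
      · have : (⌊y⌋ : ℝ) + 2 ≤ (j : ℝ) := by
          have : ⌊y⌋ + 2 ≤ j := by omega
          exact_mod_cast this
        have := neg_le_abs (y - j)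
        linarith
    simp [this]

lemma PL_near {k : ℕ} {f : ℤ → ℝ} {c : ℝ} (hc : Bd c (bdiff f)) (x : ℝ) :
    |PL k f x - f ⌊2 ^ k * x⌋| ≤ c := by
  rw [PL_eq, add_sub_cancel_left, abs_mul, abs_of_nonneg (Int.fract_nonneg _)]
  have h := hc (⌊2 ^ k * x⌋ + 1)
  simp only [bdiff, add_sub_cancel_right] at h
  exact (mul_le_of_le_one_left (abs_nonneg _) (Int.fract_lt_one _).le).trans h

lemma lip_nat {f : ℤ → ℝ} {c : ℝ} (hc : Bd c (bdiff f)) (i : ℤ) (m : ℕ) :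
    |f (i + m) - f i| ≤ m * c := by
  induction m with
  | zero => simp
  | succ m ih =>
    have h := hc (i + m + 1)
    simp only [bdiff, add_sub_cancel_right] at h
    have := abs_add_le (f (i + m + 1) - f (i + m)) (f (i + m) - f i)
    rw [sub_add_sub_cancel] at this
    push_cast
    rw [← add_assoc]
    linarith

lemma lip {f : ℤ → ℝ} {c : ℝ} (hc : Bd c (bdiff f)) {i j : ℤ} {m : ℕ} (h1 : j - i ≤ m)
    (h2 : i - j ≤ m) : |f j - f i| ≤ m * c := by
  rcases le_total i j with h | h
  · obtain ⟨d, hd⟩ := Int.eq_ofNat_of_zero_le (sub_nonneg.2 h)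
    have : j = i + d := by linarith
    rw [this]
    refine (lip_nat hc i d).trans (mul_le_mul_of_nonneg_right ?_ hc.nonneg)
    exact_mod_cast (by omega : d ≤ m)
  · obtain ⟨d, hd⟩ := Int.eq_ofNat_of_zero_le (sub_nonneg.2 h)
    have : i = j + d := by linarith
    rw [this, abs_sub_comm]
    refine (lip_nat hc j d).trans (mul_le_mul_of_nonneg_right ?_ hc.nonneg)
    exact_mod_cast (by omega : d ≤ m)

lemma step {M : ℕ} {q f : ℤ → ℝ} {b c c' : ℝ} (hq : SuppIn M q) (hr : ReproducesConstants q)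
    (hb : Bd b q) (hc : Bd c (bdiff f)) (hc' : Bd c' (bdiff (subOp q f))) (k : ℕ) (x : ℝ) :
    |PL (k + 1) (subOp q f) x - PL k f x| ≤ c' + (2 * M + 3) * (b * ((M + 1) * c)) + c := by
  have h1 := PL_near (k := k + 1) hc' x
  have h2 := PL_near (k := k) hc x
  set m := ⌊(2 : ℝ) ^ (k + 1) * x⌋ with hm
  set i := ⌊(2 : ℝ) ^ k * x⌋ with hi
  have hmi : m / 2 = i := by
    have a1 : (2 * i : ℤ) ≤ m := by
      rw [hm, Int.le_floor]
      push_cast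
      have := Int.floor_le ((2 : ℝ) ^ k * x)
      rw [pow_succ]; linarith
    have a2 : m < 2 * i + 2 := by
      rw [hm, Int.floor_lt]
      push_cast
      have := Int.lt_floor_add_one ((2 : ℝ) ^ k * x)
      rw [pow_succ]; linarith
    omega
  have h3 : |subOp q f m - f i| ≤ (2 * M + 3) * (b * ((M + 1) * c)) := by
    have e : subOp q f m - f i = ∑ j ∈ JJ M m, q (m - 2 * j) * (f j - f i) := by
      simp only [mul_sub, Finset.sum_sub_distrib]
      rw [← Finset.sum_mul, subOp_const hq hr, subOp_eq hq, one_mul]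
    rw [e]
    calc _ ≤ ∑ j ∈ JJ M m, |q (m - 2 * j) * (f j - f i)| := Finset.abs_sum_le_sum_abs _ _
      _ ≤ ∑ j ∈ JJ M m, b * ((M + 1) * c) := by
        apply Finset.sum_le_sum
        intro j hj
        simp only [JJ, Finset.mem_Icc, hmi] at hj
        rw [abs_mul]
        refine mul_le_mul (hb _) ?_ (abs_nonneg _) hb.nonneg
        have := lip hc (i := i) (j := j) (m := M + 1) (by push_cast; omega) (by push_cast; omega)
        exact_mod_cast this
      _ = _ := by rw [Finset.sum_const, nsmul_eq_mul, JJ_card]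
  rw [abs_le] at *
  constructor <;> linarith

lemma SuppIn.bd {M : ℕ} {q : ℤ → ℝ} (hq : SuppIn M q) : ∃ b, Bd b q := by
  refine ⟨∑ j ∈ Finset.Icc (-(M : ℤ)) M, |q j|, fun i => ?_⟩
  by_cases hi : i ∈ Finset.Icc (-(M : ℤ)) M
  · exact Finset.single_le_sum (f := fun j => |q j|) (fun _ _ => abs_nonneg _) hi
  · have : q i = 0 := by
      apply hq
      simp only [Finset.mem_Icc] at hi
      rw [lt_abs]
      omega
    rw [this, abs_zero]
    exact Finset.sum_nonneg fun _ _ => abs_nonneg _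

lemma core
    (astar : ℤ → ℝ) (hfin : (Function.support astar).Finite)
    (hrc : ReproducesConstants astar)
    (n : ℕ) (hn : 0 < n) (μstar : ℝ)
    (hμdef : μstar = opNorm ((subOp (diffMask astar))^[n]))
    (a : ℕ → ℤ → ℝ) (N : ℕ)
    (hlocal : ∀ k, ∀ i : ℤ, (N : ℤ) < |i| → a k i = 0)
    (hrc' : ∀ k, ReproducesConstants (a k))
    (hsim : AsympSimilar a (fun _ => astar)) (η : ℝ)
    (hη : μstar ^ ((1 : ℝ) / (n : ℝ)) < η) :
    ∃ C : ℝ, 0 < C ∧ ∀ f0 : ℤ → ℝ, IsBoundedSeq f0 → ∀ fs : ℕ → ℤ → ℝ, fs 0 = f0 →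
          (∀ k, fs (k + 1) = subOp (a k) (fs k)) → ∀ k x,
          |PL (k + 1) (fs (k + 1)) x - PL k (fs k) x| ≤ C * seqNorm (bdiff f0) * η ^ k := by
  have hμ0 : 0 ≤ μstar := hμdef ▸ opNorm_nonneg _
  have hη0 : 0 < η := (Real.rpow_nonneg hμ0 _).trans_lt hη
  have hμη : μstar < η ^ n := by
    have := pow_lt_pow_left₀ hη (Real.rpow_nonneg hμ0 _) hn.ne'
    rwa [one_div, Real.rpow_inv_natCast_pow hμ0 hn.ne'] at this
  -- common support
  obtain ⟨M0, hM0⟩ : ∃ M0 : ℕ, SuppIn M0 astar := by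
    obtain ⟨M0, hM0⟩ := (hfin.image Int.natAbs).bddAbove
    refine ⟨M0, fun i hi => ?_⟩
    by_contra hc
    have := hM0 ⟨i, hc, rfl⟩
    rw [lt_abs] at hi
    omega
  set M := max M0 N with hM
  have hs : SuppIn M astar := fun i hi => hM0 i (lt_of_le_of_lt (by simp [hM]) hi)
  have ha : ∀ k, SuppIn M (a k) := fun k i hi => hlocal k i (lt_of_le_of_lt (by simp [hM]) hi)
  have hdiff : ∀ k, Bd (seqNorm (fun i => a k i - astar i)) (a k - astar) := by
    intro k
    obtain ⟨c, hc⟩ := ((ha k).sub hs).bd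
    exact hc.seqNorm
  obtain ⟨bs, hbs⟩ := hs.bd
  obtain ⟨B, hB⟩ := hsim.bddAbove_range
  have hdB : ∀ k, Bd B (a k - astar) := fun k => (hdiff k).mono (hB ⟨k, rfl⟩)
  have hB0 : 0 ≤ B := (hdB 0).nonneg
  set b := B + bs with hb
  have hab : ∀ k, Bd b (a k) := by
    intro k
    have := (hdB k).add hbs
    rwa [sub_add_cancel] at this
  have hsb : Bd b astar := hbs.mono (by linarith)
  have hb0 : 0 ≤ b := hsb.nonneg
  set β := (2 * (M : ℝ) + 1) * b with hβ
  have hps : ∀ k, SuppIn M (diffMask (a k)) := fun k => diffMask_supp (ha k) (hrc' k)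
  have hpb : ∀ k, Bd β (diffMask (a k)) := fun k => diffMask_bd (ha k) (hab k)
  have hqs := diffMask_supp hs hrc
  have hqb : Bd β (diffMask astar) := diffMask_bd hs hsb
  have hlim : ∀ ε > 0, ∃ K : ℕ, ∀ k ≥ K, Bd ε (diffMask (a k) - diffMask astar) := by
    intro ε hε
    have h1 : 0 < ε / (2 * M + 1) := by positivity
    obtain ⟨K, hK⟩ := Filter.eventually_atTop.1 (hsim.eventually_lt_const h1)
    refine ⟨K, fun k hk => ?_⟩
    rw [← diffMask_sub (ha k) hs]
    have h2 := diffMask_bd ((ha k).sub hs) ((hdiff k).mono (hK k hk).le)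
    rwa [mul_div_cancel₀ _ (by positivity)] at h2
  obtain ⟨K, hK⟩ := perturb hps hpb hqs hqb hlim n (η ^ n - μstar) (by linarith)
  obtain ⟨C, hC, hdec⟩ := decay hps hpb hn hη0 (K := K) (by
    intro k hk D hD c hc
    have h1 := hK k hk D hD c hc
    have h2 := opNorm_bd hqs hqb hc n
    have h3 := h1.add h2
    rw [sub_add_cancel, ← hμdef] at h3
    exact h3.mono (le_of_eq (by ring)))
  refine ⟨C * η + (2 * M + 3) * (b * ((M + 1) * C)) + C, by positivity, ?_⟩
  intro f0 ⟨m0, hm0⟩ fs hfs0 hfs k x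
  have hD : ∀ k, bdiff (fs (k + 1)) = subOp (diffMask (a k)) (bdiff (fs k)) := by
    intro k
    rw [hfs, bdiff_subOp (ha k) (hrc' k)]
  have hbd0 : Bd (seqNorm (bdiff f0)) (bdiff (fs 0)) := by
    rw [hfs0]
    apply Bd.seqNorm (c := m0 + m0)
    intro i
    exact (abs_sub _ _).trans (add_le_add (hm0 _) (hm0 _))
  have hd := hdec (fun k => bdiff (fs k)) hD _ hbd0
  have h1 := hd k
  have h2 := hd (k + 1)
  simp only [hfs k] at h2
  have h3 := step (ha k) (hrc' k) (hab k) h1 h2 k x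
  rw [hfs k]
  refine h3.trans (le_of_eq ?_)
  ring

/-- a non-stationary scheme reproducing constants which is asymptotically
similar to a convergent stationary scheme `{S_{a*}}` with `μ* = ‖(S_{q*})^n‖ < 1`
converges, with error bound `‖S^∞ f⁰ − PL(f^[k+1])‖ ≤ C η^k ‖Δ f⁰‖` for every
`η ∈ ((μ*)^{1/n}, 1)`. -/
theorem main_theorem
    (astar : ℤ → ℝ) (hfin : (Function.support astar).Finite)
    (hrc : ReproducesConstants astar)
    (hconv : ∀ f0 : ℤ → ℝ, IsBoundedSeq f0 →
      ∃ g : ℝ → ℝ, TendstoUniformly (fun k => PL k ((subOp astar)^[k] f0)) g atTop)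
    (n : ℕ) (hn : 0 < n) (μstar : ℝ)
    (hμdef : μstar = opNorm ((subOp (diffMask astar))^[n])) (hμlt : μstar < 1)
    (a : ℕ → ℤ → ℝ) (N : ℕ) (hN : 0 < N)
    (hlocal : ∀ k, ∀ i : ℤ, (N : ℤ) < |i| → a k i = 0)
    (hrc' : ∀ k, ReproducesConstants (a k))
    (hsim : AsympSimilar a (fun _ => astar)) :
    (∀ f0 : ℤ → ℝ, IsBoundedSeq f0 → ∀ fs : ℕ → ℤ → ℝ, fs 0 = f0 →
        (∀ k, fs (k + 1) = subOp (a k) (fs k)) →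
        ∃ g : ℝ → ℝ, TendstoUniformly (fun k => PL k (fs k)) g atTop) ∧
      ∀ η : ℝ, η ∈ Set.Ioo (μstar ^ ((1 : ℝ) / (n : ℝ))) 1 →
        ∃ C : ℝ, 0 < C ∧ ∀ f0 : ℤ → ℝ, IsBoundedSeq f0 → ∀ fs : ℕ → ℤ → ℝ, fs 0 = f0 →
          (∀ k, fs (k + 1) = subOp (a k) (fs k)) →
          ∀ g : ℝ → ℝ, TendstoUniformly (fun k => PL k (fs k)) g atTop →
          ∀ k : ℕ, (⨆ x : ℝ, |g x - PL (k + 1) (fs (k + 1)) x|) ≤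
            C * η ^ k * seqNorm (bdiff f0) := by
  have hμ0 : 0 ≤ μstar := hμdef ▸ opNorm_nonneg _
  have hcore := core astar hfin hrc n hn μstar hμdef a N hlocal hrc' hsim
  constructor
  · intro f0 hf0 fs hfs0 hfs
    have hlt : μstar ^ ((1 : ℝ) / (n : ℝ)) < 1 :=
      Real.rpow_lt_one hμ0 hμlt (by positivity)
    obtain ⟨η, hη, hη1⟩ := exists_between hlt
    have hη0 : 0 < η := (Real.rpow_nonneg hμ0 _).trans_lt hη
    obtain ⟨C, hC, H⟩ := hcore η hη
    have H' : ∀ x k, dist (PL k (fs k) x) (PL (k + 1) (fs (k + 1)) x)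
        ≤ C * seqNorm (bdiff f0) * η ^ k := by
      intro x k
      rw [dist_comm, Real.dist_eq]
      exact H f0 hf0 fs hfs0 hfs k x
    have hex : ∀ x, ∃ y, Tendsto (fun k => PL k (fs k) x) atTop (nhds y) := fun x =>
      cauchySeq_tendsto_of_complete (cauchySeq_of_le_geometric η _ hη1 (H' x))
    choose g hg using hex
    refine ⟨g, Metric.tendstoUniformly_iff.2 fun ε hε => ?_⟩
    have hb : ∀ k x, dist (g x) (PL k (fs k) x) ≤ C * seqNorm (bdiff f0) * η ^ k / (1 - η) := by
      intro k x
      rw [dist_comm]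
      exact dist_le_of_le_geometric_of_tendsto η _ hη1 (H' x) (hg x) k
    have hlim : Tendsto (fun k : ℕ => C * seqNorm (bdiff f0) * η ^ k / (1 - η)) atTop (nhds 0) := by
      have := ((tendsto_pow_atTop_nhds_zero_of_lt_one hη0.le hη1).const_mul
        (C * seqNorm (bdiff f0))).div_const (1 - η)
      simpa using this
    filter_upwards [hlim.eventually_lt_const hε] with k hk x
    exact (hb k x).trans_lt hk
  · rintro η ⟨hη, hη1⟩
    have hη0 : 0 < η := (Real.rpow_nonneg hμ0 _).trans_lt hη
    have h1η : 0 < 1 - η := by linarith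
    obtain ⟨C, hC, H⟩ := hcore η hη
    refine ⟨C / (1 - η), by positivity, fun f0 hf0 fs hfs0 hfs g hg k => ?_⟩
    have hs := seqNorm_nonneg (bdiff f0)
    refine Real.iSup_le (fun x => ?_) (by positivity)
    have h1 : dist (PL (k + 1) (fs (k + 1)) x) (g x)
        ≤ C * seqNorm (bdiff f0) * η ^ (k + 1) / (1 - η) := by
      refine dist_le_of_le_geometric_of_tendsto η _ hη1 (fun k => ?_) (hg.tendsto_at x) (k + 1)
      rw [dist_comm, Real.dist_eq]
      exact H f0 hf0 fs hfs0 hfs k x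
    rw [dist_comm, Real.dist_eq] at h1
    refine h1.trans ?_
    have e : C / (1 - η) * η ^ k * seqNorm (bdiff f0)
        = C * seqNorm (bdiff f0) * η ^ k / (1 - η) := by ring
    rw [e]
    have : η ^ (k + 1) ≤ η ^ k := pow_le_pow_of_le_one hη0.le hη1.le (Nat.le_succ k)
    gcongr
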